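/- arXiv:2508.12288 — 5 statements merged into one kernel-verified Lean document; each statement's English description precedes it below -/
import Mathlib

section
/- Let E be a finite-dimensional real inner product space and T > 0. Let A : [0,T] → (E →L[ℝ] E) be continuous, let b, G : [0,T] → E be continuous, and let D, Λ : [0,T] → E be differentiable with D(0) = 0, D'(t) = A(t)(D(t)) + b(t) for all t ∈ [0,T], and Λ'(t) = −( (A(t))† (Λ(t)) + G(t) ) for all t ∈ [0,T], where (A(t))† denotes the adjoint of A(t) with respect to the inner product of E. Then ⟨Λ(T), D(T)⟩ + ∫₀ᵀ ⟨G(t), D(t)⟩ dt = ∫₀ᵀ ⟨Λ(t), b(t)⟩ dt. -/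
open scoped RealInnerProductSpace

/-- Adjoint duality (integration by parts) for a linear ODE and its backwards adjoint:
if `D' = A D + b`, `D(0) = 0`, and `Λ' = −(A† Λ + G)`, then
`⟨Λ(T), D(T)⟩ + ∫₀ᵀ ⟨G, D⟩ = ∫₀ᵀ ⟨Λ, b⟩`. -/
theorem adjoint_duality_identity
    {E : Type*} [NormedAddCommGroup E] [InnerProductSpace ℝ E] [FiniteDimensional ℝ E]
    (T : ℝ) (hT : 0 < T)
    (A : ℝ → (E →L[ℝ] E)) (hA : ContinuousOn A (Set.Icc 0 T))
    (b G : ℝ → E) (hb : ContinuousOn b (Set.Icc 0 T)) (hG : ContinuousOn G (Set.Icc 0 T))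
    (D Λ : ℝ → E)
    (hD0 : D 0 = 0)
    (hD : ∀ t ∈ Set.Icc (0 : ℝ) T, HasDerivAt D (A t (D t) + b t) t)
    (hΛ : ∀ t ∈ Set.Icc (0 : ℝ) T,
      HasDerivAt Λ (-(ContinuousLinearMap.adjoint (A t) (Λ t) + G t)) t) :
    ⟪Λ T, D T⟫ + ∫ t in (0 : ℝ)..T, ⟪G t, D t⟫ = ∫ t in (0 : ℝ)..T, ⟪Λ t, b t⟫ := by
  have hu : Set.uIcc (0 : ℝ) T = Set.Icc 0 T := Set.uIcc_of_le hT.le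
  have hDc : ContinuousOn D (Set.Icc 0 T) := HasDerivAt.continuousOn hD
  have hΛc : ContinuousOn Λ (Set.Icc 0 T) := HasDerivAt.continuousOn hΛ
  have i1 : IntervalIntegrable (fun t => ⟪Λ t, b t⟫) MeasureTheory.volume 0 T := by
    apply ContinuousOn.intervalIntegrable
    rw [hu]
    exact hΛc.inner hb
  have i2 : IntervalIntegrable (fun t => ⟪G t, D t⟫) MeasureTheory.volume 0 T := by
    apply ContinuousOn.intervalIntegrable
    rw [hu]
    exact hG.inner hDc
  have key := intervalIntegral.integral_eq_sub_of_hasDerivAt (a := 0) (b := T)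
    (f := fun t => ⟪Λ t, D t⟫) (f' := fun t => ⟪Λ t, b t⟫ - ⟪G t, D t⟫)
    (by
      intro t ht
      rw [hu] at ht
      have h := (hΛ t ht).inner ℝ (hD t ht)
      refine HasDerivAt.congr_deriv h ?_
      rw [inner_add_right, inner_neg_left, inner_add_left,
        ContinuousLinearMap.adjoint_inner_left]
      ring) (i1.sub i2)
  rw [intervalIntegral.integral_sub i1 i2] at key
  simp only [hD0, inner_zero_right] at key
  linarith
end

section
/- Let n ∈ ℕ, T > 0, and work with real n×n matrices with the Frobenius inner product ⟪M,N⟫ = trace(Mᵀ N). Let L be a fixed matrix, let A, Σ : [0,T] → Matrix be continuous with A(t) symmetric, and let ξ, h : [0,T] → ℝ be continuous. Let C : ℝ × [0,T] → Matrix satisfy C(ε,0) = C₀ with C₀ symmetric, and ∂ₜ C(ε,t) = L·C(ε,t) + C(ε,t)·Lᵀ + Σ(t) − (ξ(t) + ε h(t))·C(ε,t)·A(t)·C(ε,t), with C(0,t) symmetric for all t. Assume the sensitivity D(t) := ∂_ε C(ε,t)|_{ε=0} exists, is continuous, satisfies D(0) = 0 and D'(t) = L·D(t) + D(t)·Lᵀ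 − ξ(t)(D(t)·A(t)·C(0,t) + C(0,t)·A(t)·D(t)) − h(t)·C(0,t)·A(t)·C(0,t). Let U_final be Fréchet differentiable at C(0,T) with Frobenius gradient G_f, U_int(t,·) Fréchet differentiable at C(0,t) with Frobenius gradient G_int(t) continuous in t, and suppose ε ↦ U_final(C(ε,T)) + ∫₀ᵀ U_int(t,C(ε,t)) dt is differentiable at 0 with derivative ⟪G_f, D(T)⟫ + ∫₀ᵀ ⟪G_int(t), D(t)⟫ dt. Let Λ : [0,T] → Matrix be differentiable with Λ(T) = G_f and −Λ'(t) = Lᵀ·Λ(t) + Λ(t)·L − ξ(t)(A(t)·C(0,t)·Λ(t) + Λ(t)·C(0,t)·A(t)) + G_int(t). Then d/dε [ U_final(C(ε,T)) + ∫₀ᵀ U_int(t, C(ε,t)) dt ] at ε = 0 equals −∫₀ᵀ ⟪Λ(t), C(0,t)·A(t)·C(0,t)⟫ · h(t) dt. -/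
open Matrix

noncomputable section

attribute [local instance] Matrix.frobeniusNormedAddCommGroup Matrix.frobeniusNormedSpace

/-- The Frobenius inner product `⟪M,N⟫ = trace(Mᵀ N)` of real square matrices. -/
def frob {n : ℕ} (M N : Matrix (Fin n) (Fin n) ℝ) : ℝ := (Mᵀ * N).trace

theorem frob_eq_sum_aux {n : ℕ} (M N : Matrix (Fin n) (Fin n) ℝ) :
    frob M N = ∑ i, ∑ j, M j i * N j i := by
  simp [frob, Matrix.trace, Matrix.mul_apply]

theorem entry_hasDerivAt_aux {n : ℕ} {M : ℝ → Matrix (Fin n) (Fin n) ℝ}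
    {M' : Matrix (Fin n) (Fin n) ℝ} {t : ℝ} (hM : HasDerivAt M M' t) (i j : Fin n) :
    HasDerivAt (fun s => M s i j) (M' i j) t :=
  (LinearMap.toContinuousLinearMap
    (Matrix.entryLinearMap ℝ ℝ i j)).hasFDerivAt.comp_hasDerivAt t hM

theorem frob_hasDerivAt_aux {n : ℕ} {M N : ℝ → Matrix (Fin n) (Fin n) ℝ}
    {M' N' : Matrix (Fin n) (Fin n) ℝ} {t : ℝ} (hM : HasDerivAt M M' t)
    (hN : HasDerivAt N N' t) :
    HasDerivAt (fun s => frob (M s) (N s)) (frob M' (N t) + frob (M t) N') t := by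
  simp only [frob_eq_sum_aux, ← Finset.sum_add_distrib]
  exact HasDerivAt.fun_sum fun i _ => HasDerivAt.fun_sum fun j _ =>
    (entry_hasDerivAt_aux hM j i).mul (entry_hasDerivAt_aux hN j i)

theorem frob_continuousOn_aux {n : ℕ} {M N : ℝ → Matrix (Fin n) (Fin n) ℝ} {s : Set ℝ}
    (hM : ContinuousOn M s) (hN : ContinuousOn N s) :
    ContinuousOn (fun t => frob (M t) (N t)) s := by
  have e : ∀ {M : ℝ → Matrix (Fin n) (Fin n) ℝ}, ContinuousOn M s → ∀ i j,
      ContinuousOn (fun t => M t i j) s := fun hM i j =>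
    (LinearMap.toContinuousLinearMap
      (Matrix.entryLinearMap ℝ ℝ i j)).continuous.comp_continuousOn hM
  simp only [frob_eq_sum_aux]
  exact continuousOn_finsetSum _ fun i _ => continuousOn_finsetSum _ fun j _ =>
    (e hM j i).mul (e hN j i)

theorem mul_continuousOn_aux {n : ℕ} {M N : ℝ → Matrix (Fin n) (Fin n) ℝ} {s : Set ℝ}
    (hM : ContinuousOn M s) (hN : ContinuousOn N s) :
    ContinuousOn (fun t => M t * N t) s := by
  have h1 : Continuous fun p : Matrix (Fin n) (Fin n) ℝ × Matrix (Fin n) (Fin n) ℝ =>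
      p.1 * p.2 := continuous_fst.matrix_mul continuous_snd
  exact h1.comp_continuousOn (hM.prodMk hN)

theorem adjoint_identity_aux {n : ℕ} (L A C D Λ G : Matrix (Fin n) (Fin n) ℝ) (x h : ℝ)
    (hA : A.IsSymm) (hC : C.IsSymm) :
    frob (-(Lᵀ * Λ + Λ * L - x • (A * C * Λ + Λ * C * A) + G)) D
      + frob Λ (L * D + D * Lᵀ - x • (D * A * C + C * A * D) - h • (C * A * C))
      = -frob G D - frob Λ (C * A * C) * h := by
  have e1 : (Λᵀ * (D * Lᵀ)).trace = (Lᵀ * (Λᵀ * D)).trace := by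
    rw [← Matrix.mul_assoc, Matrix.trace_mul_comm]
  have e2 : (Λᵀ * (D * (A * C))).trace = (A * (C * (Λᵀ * D))).trace := by
    rw [← Matrix.mul_assoc, Matrix.trace_mul_comm, Matrix.mul_assoc]
  simp only [frob, Matrix.transpose_neg, Matrix.transpose_add, Matrix.transpose_sub,
    Matrix.transpose_smul, Matrix.transpose_mul, Matrix.transpose_transpose, hA.eq, hC.eq,
    Matrix.neg_mul, Matrix.add_mul, Matrix.sub_mul, Matrix.mul_add, Matrix.mul_sub,
    Matrix.smul_mul, Matrix.mul_smul, Matrix.trace_neg, Matrix.trace_add, Matrix.trace_sub,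
    Matrix.trace_smul, Matrix.mul_assoc, smul_eq_mul, e1, e2]
  ring

/-- Gradient of the utility `V(ξ) = U_final(C(T)) + ∫₀ᵀ U_int(t,C(t)) dt` for the
linear-Gaussian scheduled filtering problem, where `C` solves the weighted Kalman–Bucy
Riccati equation `Ċ = LC + CLᵀ + Σ(t) − ξ(t) C A(t) C`: the Gateaux derivative in
direction `h` equals `−∫₀ᵀ ⟪Λ(t), C(t)A(t)C(t)⟫ h(t) dt` with `Λ` solving the
backwards adjoint equation. -/
theorem linear_gaussian_utility_gradient
    (n : ℕ) (T : ℝ) (hT : 0 < T)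
    (L : Matrix (Fin n) (Fin n) ℝ)
    (A Sig : ℝ → Matrix (Fin n) (Fin n) ℝ)
    (hAcont : ContinuousOn A (Set.Icc 0 T)) (hSigcont : ContinuousOn Sig (Set.Icc 0 T))
    (hAsymm : ∀ t ∈ Set.Icc (0 : ℝ) T, (A t).IsSymm)
    (ξ h : ℝ → ℝ) (hξ : ContinuousOn ξ (Set.Icc 0 T)) (hh : ContinuousOn h (Set.Icc 0 T))
    (C₀ : Matrix (Fin n) (Fin n) ℝ) (hC₀ : C₀.IsSymm)
    (C : ℝ → ℝ → Matrix (Fin n) (Fin n) ℝ)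
    (hC0 : ∀ ε, C ε 0 = C₀)
    (hCode : ∀ ε, ∀ t ∈ Set.Icc (0 : ℝ) T,
      HasDerivAt (C ε)
        (L * C ε t + C ε t * Lᵀ + Sig t - (ξ t + ε * h t) • (C ε t * A t * C ε t)) t)
    (hCsymm : ∀ t ∈ Set.Icc (0 : ℝ) T, (C 0 t).IsSymm)
    -- the sensitivity `D(t) = ∂_ε C(ε,t)|_{ε=0}` exists, is continuous, `D(0) = 0`,
    -- and solves the linearized ODE
    (D : ℝ → Matrix (Fin n) (Fin n) ℝ)
    (hDdef : ∀ t ∈ Set.Icc (0 : ℝ) T, HasDerivAt (fun ε => C ε t) (D t) 0)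
    (hDcont : ContinuousOn D (Set.Icc 0 T))
    (hD0 : D 0 = 0)
    (hDode : ∀ t ∈ Set.Icc (0 : ℝ) T, HasDerivAt D
      (L * D t + D t * Lᵀ - ξ t • (D t * A t * C 0 t + C 0 t * A t * D t)
        - h t • (C 0 t * A t * C 0 t)) t)
    -- `U_final` is Fréchet differentiable at `C(0,T)` with Frobenius gradient `G_f`
    (Ufinal : Matrix (Fin n) (Fin n) ℝ → ℝ) (Gf : Matrix (Fin n) (Fin n) ℝ)
    (hUf : DifferentiableAt ℝ Ufinal (C 0 T))
    (hGf : ∀ M, fderiv ℝ Ufinal (C 0 T) M = frob Gf M)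
    -- `U_int(t,·)` is Fréchet differentiable at `C(0,t)` with Frobenius gradient `G_int(t)`
    (Uint : ℝ → Matrix (Fin n) (Fin n) ℝ → ℝ) (Gint : ℝ → Matrix (Fin n) (Fin n) ℝ)
    (hGintcont : ContinuousOn Gint (Set.Icc 0 T))
    (hUint : ∀ t ∈ Set.Icc (0 : ℝ) T, DifferentiableAt ℝ (Uint t) (C 0 t))
    (hGint : ∀ t ∈ Set.Icc (0 : ℝ) T, ∀ M, fderiv ℝ (Uint t) (C 0 t) M = frob (Gint t) M)
    -- the utility is differentiable in `ε` at `0`, with derivative given by the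
    -- chain rule through the sensitivity `D`
    (hdV : HasDerivAt (fun ε => Ufinal (C ε T) + ∫ t in (0 : ℝ)..T, Uint t (C ε t))
      (frob Gf (D T) + ∫ t in (0 : ℝ)..T, frob (Gint t) (D t)) 0)
    -- the adjoint variable: `Λ(T) = G_f` and
    -- `−Λ'(t) = LᵀΛ + ΛL − ξ(t)(A C Λ + Λ C A) + G_int(t)`
    (Λ : ℝ → Matrix (Fin n) (Fin n) ℝ)
    (hΛT : Λ T = Gf)
    (hΛ : ∀ t ∈ Set.Icc (0 : ℝ) T, HasDerivAt Λ
      (-(Lᵀ * Λ t + Λ t * L - ξ t • (A t * C 0 t * Λ t + Λ t * C 0 t * A t)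
          + Gint t)) t) :
    HasDerivAt (fun ε => Ufinal (C ε T) + ∫ t in (0 : ℝ)..T, Uint t (C ε t))
      (-∫ t in (0 : ℝ)..T, frob (Λ t) (C 0 t * A t * C 0 t) * h t) 0 := by
  have hΛc : ContinuousOn Λ (Set.Icc 0 T) :=
    fun t ht => (hΛ t ht).continuousAt.continuousWithinAt
  have hCc : ContinuousOn (C 0) (Set.Icc 0 T) :=
    fun t ht => (hCode 0 t ht).continuousAt.continuousWithinAt
  have c1 : ContinuousOn (fun t => frob (Gint t) (D t)) (Set.Icc 0 T) :=
    frob_continuousOn_aux hGintcont hDcont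
  have c2 : ContinuousOn (fun t => frob (Λ t) (C 0 t * A t * C 0 t) * h t) (Set.Icc 0 T) :=
    (frob_continuousOn_aux hΛc
      (mul_continuousOn_aux (mul_continuousOn_aux hCc hAcont) hCc)).mul hh
  have hu : Set.uIcc 0 T = Set.Icc 0 T := Set.uIcc_of_le hT.le
  have i1 := ContinuousOn.intervalIntegrable (μ := MeasureTheory.volume) (hu ▸ c1)
  have i2 := ContinuousOn.intervalIntegrable (μ := MeasureTheory.volume) (hu ▸ c2)
  have i1n : IntervalIntegrable (fun t => -frob (Gint t) (D t)) MeasureTheory.volume 0 T := i1.neg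
  have key := intervalIntegral.integral_eq_sub_of_hasDerivAt
    (f := fun t => frob (Λ t) (D t))
    (f' := fun t => -frob (Gint t) (D t) - frob (Λ t) (C 0 t * A t * C 0 t) * h t)
    (a := 0) (b := T)
    (fun t ht => by
      rw [hu] at ht
      rw [← adjoint_identity_aux L (A t) (C 0 t) (D t) (Λ t) (Gint t) (ξ t) (h t)
        (hAsymm t ht) (hCsymm t ht)]
      exact frob_hasDerivAt_aux (hΛ t ht) (hDode t ht))
    (i1n.sub i2)
  have hz : frob (Λ 0) (D 0) = 0 := by simp [hD0, frob]
  rw [intervalIntegral.integral_sub i1n i2, intervalIntegral.integral_neg, hz, hΛT] at key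
  convert hdV using 1
  linarith
end
end

section
/- Let n ∈ ℕ, let f : ℝⁿ → ℝⁿ be continuously differentiable, let Σ be a constant symmetric real n×n matrix, and let p, λ : ℝⁿ → ℝ be twice continuously differentiable with p(x) > 0 for all x. Define (ℒφ)(x) = ⟨f(x), ∇φ(x)⟩ + (1/2)·trace(Σ·Hess φ(x)) and (ℒ*q)(x) = −div(y ↦ q(y)·f(y))(x) + (1/2)·trace(Σ·Hess q(x)). Then for all x ∈ ℝⁿ, p(x)·(ℒ(λ/p))(x) − (λ(x)/p(x))·(ℒ*p)(x) = div( y ↦ λ(y)·( f(y) − Σ·∇p(y)/p(y) ) + (1/2)·Σ·∇λ(y) )(x). -/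
noncomputable section

/-- Partial derivative `∂ᵢ g (x)`. -/
def pd {n : ℕ} (i : Fin n) (g : EuclideanSpace ℝ (Fin n) → ℝ)
    (x : EuclideanSpace ℝ (Fin n)) : ℝ :=
  fderiv ℝ g x (EuclideanSpace.single i 1)

/-- The gradient `∇g(x)` as a vector of partial derivatives. -/
def gradv {n : ℕ} (g : EuclideanSpace ℝ (Fin n) → ℝ) (x : EuclideanSpace ℝ (Fin n)) :
    Fin n → ℝ := fun i => pd i g x

/-- The Hessian matrix `(Hess g)(x)ᵢⱼ = ∂ᵢ∂ⱼ g(x)`. -/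
def hess {n : ℕ} (g : EuclideanSpace ℝ (Fin n) → ℝ) (x : EuclideanSpace ℝ (Fin n)) :
    Matrix (Fin n) (Fin n) ℝ := Matrix.of fun i j => pd i (pd j g) x

/-- The divergence `div F(x) = Σᵢ ∂ᵢ Fᵢ(x)` of a vector field. -/
def divv {n : ℕ} (F : EuclideanSpace ℝ (Fin n) → Fin n → ℝ)
    (x : EuclideanSpace ℝ (Fin n)) : ℝ := ∑ i, pd i (fun y => F y i) x

/-- The infinitesimal generator `(ℒφ)(x) = ⟨f(x), ∇φ(x)⟩ + ½ trace(Σ Hess φ(x))`. -/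
def gen {n : ℕ} (f : EuclideanSpace ℝ (Fin n) → EuclideanSpace ℝ (Fin n))
    (Sig : Matrix (Fin n) (Fin n) ℝ) (φ : EuclideanSpace ℝ (Fin n) → ℝ)
    (x : EuclideanSpace ℝ (Fin n)) : ℝ :=
  (∑ i, f x i * pd i φ x) + (1 / 2) * Matrix.trace (Sig * hess φ x)

/-- The formal adjoint `(ℒ*q)(x) = −div(q f)(x) + ½ trace(Σ Hess q(x))`. -/
def genAdj {n : ℕ} (f : EuclideanSpace ℝ (Fin n) → EuclideanSpace ℝ (Fin n))
    (Sig : Matrix (Fin n) (Fin n) ℝ) (q : EuclideanSpace ℝ (Fin n) → ℝ)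
    (x : EuclideanSpace ℝ (Fin n)) : ℝ :=
  -divv (fun y i => q y * f y i) x + (1 / 2) * Matrix.trace (Sig * hess q x)


lemma pd_mul' {n : ℕ} (i : Fin n) {g h : EuclideanSpace ℝ (Fin n) → ℝ}
    {x : EuclideanSpace ℝ (Fin n)} (hg : DifferentiableAt ℝ g x) (hh : DifferentiableAt ℝ h x) :
    pd i (fun y => g y * h y) x = pd i g x * h x + g x * pd i h x := by
  unfold pd
  rw [fderiv_fun_mul hg hh]
  simp
  ring

lemma pd_add' {n : ℕ} (i : Fin n) {g h : EuclideanSpace ℝ (Fin n) → ℝ}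
    {x : EuclideanSpace ℝ (Fin n)} (hg : DifferentiableAt ℝ g x) (hh : DifferentiableAt ℝ h x) :
    pd i (fun y => g y + h y) x = pd i g x + pd i h x := by
  unfold pd
  rw [fderiv_fun_add hg hh]
  simp

lemma pd_sub' {n : ℕ} (i : Fin n) {g h : EuclideanSpace ℝ (Fin n) → ℝ}
    {x : EuclideanSpace ℝ (Fin n)} (hg : DifferentiableAt ℝ g x) (hh : DifferentiableAt ℝ h x) :
    pd i (fun y => g y - h y) x = pd i g x - pd i h x := by
  unfold pd
  rw [fderiv_fun_sub hg hh]
  simp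

lemma pd_cmul' {n : ℕ} (i : Fin n) (c : ℝ) {h : EuclideanSpace ℝ (Fin n) → ℝ}
    {x : EuclideanSpace ℝ (Fin n)} (hh : DifferentiableAt ℝ h x) :
    pd i (fun y => c * h y) x = c * pd i h x := by
  unfold pd
  rw [fderiv_const_mul hh]
  simp

lemma pd_sum' {n : ℕ} (i : Fin n) {h : Fin n → EuclideanSpace ℝ (Fin n) → ℝ}
    {x : EuclideanSpace ℝ (Fin n)} (hh : ∀ j, DifferentiableAt ℝ (h j) x) :
    pd i (fun y => ∑ j, h j y) x = ∑ j, pd i (h j) x := by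
  unfold pd
  rw [fderiv_fun_sum (fun j _ => hh j)]
  simp

lemma diff_div' {n : ℕ} {g h : EuclideanSpace ℝ (Fin n) → ℝ}
    {x : EuclideanSpace ℝ (Fin n)} (hg : DifferentiableAt ℝ g x) (hh : DifferentiableAt ℝ h x)
    (h0 : h x ≠ 0) : DifferentiableAt ℝ (fun y => g y / h y) x := by
  simp only [div_eq_mul_inv]
  exact hg.fun_mul (hh.fun_inv h0)

lemma pd_div' {n : ℕ} (i : Fin n) {g h : EuclideanSpace ℝ (Fin n) → ℝ}
    {x : EuclideanSpace ℝ (Fin n)} (hg : DifferentiableAt ℝ g x) (hh : DifferentiableAt ℝ h x)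
    (h0 : ∀ y, h y ≠ 0) :
    pd i (fun y => g y / h y) x = (pd i g x * h x - g x * pd i h x) / (h x * h x) := by
  have hd : DifferentiableAt ℝ (fun y => g y / h y) x := diff_div' hg hh (h0 x)
  have e : pd i g x = pd i (fun y => (g y / h y) * h y) x := by
    congr 1
    funext y
    field_simp [h0 y]
  rw [pd_mul' i hd hh] at e
  have := h0 x
  rw [e]
  field_simp
  ring

lemma pd_differentiable {n : ℕ} (i : Fin n) {g : EuclideanSpace ℝ (Fin n) → ℝ}
    (hg : ContDiff ℝ 2 g) : Differentiable ℝ (pd i g) := by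
  have h1 : ContDiff ℝ 1 (fderiv ℝ g) := hg.fderiv_right (by norm_num)
  have h2 : Differentiable ℝ (fderiv ℝ g) := h1.differentiable (by norm_num)
  intro x
  unfold pd
  exact (h2 x).clm_apply (differentiableAt_const _)

lemma trace_symm' {n : ℕ} (S : Matrix (Fin n) (Fin n) ℝ) (hS : S.IsSymm)
    (H : Matrix (Fin n) (Fin n) ℝ) : Matrix.trace (S * H) = ∑ i, ∑ j, S i j * H i j := by
  simp only [Matrix.trace, Matrix.diag, Matrix.mul_apply]
  rw [Finset.sum_comm]
  refine Finset.sum_congr rfl fun i _ => Finset.sum_congr rfl fun j _ => ?_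
  rw [hS.apply]

/-- Fully simplified divergence form of the adjoint operator of the log-Zakai-constrained
problem: `p ℒ(λ/p) − (λ/p) ℒ*p = ∇·( λ (f − Σ∇p/p) + ½ Σ ∇λ )`. -/
theorem generator_adjoint_divergence_form_simplified
    {n : ℕ} (f : EuclideanSpace ℝ (Fin n) → EuclideanSpace ℝ (Fin n))
    (hf : ContDiff ℝ 1 f)
    (Sig : Matrix (Fin n) (Fin n) ℝ) (hSig : Sig.IsSymm)
    (p lam : EuclideanSpace ℝ (Fin n) → ℝ)
    (hp : ContDiff ℝ 2 p) (hlam : ContDiff ℝ 2 lam)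
    (hppos : ∀ x, 0 < p x) :
    ∀ x : EuclideanSpace ℝ (Fin n),
      p x * gen f Sig (fun y => lam y / p y) x
          - (lam x / p x) * genAdj f Sig p x =
        divv (fun y i =>
          lam y * (f y i - Sig.mulVec (gradv p y) i / p y) +
            (1 / 2) * Sig.mulVec (gradv lam y) i) x := by
  intro x
  have h0 : ∀ y, p y ≠ 0 := fun y => (hppos y).ne'
  have dp : Differentiable ℝ p := hp.differentiable (by norm_num)
  have dl : Differentiable ℝ lam := hlam.differentiable (by norm_num)
  have df : ∀ i, Differentiable ℝ (fun y => f y i) := fun i =>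
    (differentiable_euclidean.1 (hf.differentiable (by norm_num))) i
  have dpp : ∀ i, Differentiable ℝ (pd i p) := fun i => pd_differentiable i hp
  have dpl : ∀ i, Differentiable ℝ (pd i lam) := fun i => pd_differentiable i hlam
  have e1 : ∀ i, pd i (fun y => lam y / p y) =
      fun y => (pd i lam y * p y - lam y * pd i p y) / (p y * p y) := fun i => by
    funext y
    exact pd_div' i (dl y) (dp y) h0
  have e2 : ∀ i j, pd i (pd j (fun y => lam y / p y)) x =
      ((pd i (pd j lam) x * p x + pd j lam x * pd i p x
        - (pd i lam x * pd j p x + lam x * pd i (pd j p) x)) * (p x * p x)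
       - (pd j lam x * p x - lam x * pd j p x) * (pd i p x * p x + p x * pd i p x))
        / ((p x * p x) * (p x * p x)) := fun i j => by
    rw [e1 j, pd_div' i (((dpl j x).fun_mul (dp x)).fun_sub ((dl x).fun_mul (dpp j x)))
      ((dp x).fun_mul (dp x)) (fun y => mul_ne_zero (h0 y) (h0 y)),
      pd_sub' i ((dpl j x).fun_mul (dp x)) ((dl x).fun_mul (dpp j x)),
      pd_mul' i (dpl j x) (dp x), pd_mul' i (dl x) (dpp j x), pd_mul' i (dp x) (dp x)]
  have dS : ∀ (g : EuclideanSpace ℝ (Fin n) → ℝ), (∀ j, Differentiable ℝ (pd j g)) → ∀ i,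
      Differentiable ℝ (fun y => ∑ j, Sig i j * pd j g y) := fun g hg i =>
    Differentiable.fun_sum fun j _ => (hg j).const_mul _
  have eS : ∀ (g : EuclideanSpace ℝ (Fin n) → ℝ), (∀ j, Differentiable ℝ (pd j g)) → ∀ i,
      pd i (fun y => ∑ j, Sig i j * pd j g y) x = ∑ j, Sig i j * pd i (pd j g) x :=
    fun g hg i => by
    rw [pd_sum' i (fun j => ((hg j).const_mul _) x)]
    exact Finset.sum_congr rfl fun j _ => pd_cmul' i _ (hg j x)
  have hR : ∀ i, pd i (fun y => lam y * (f y i - (∑ j, Sig i j * pd j p y) / p y) +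
      (1 / 2) * ∑ j, Sig i j * pd j lam y) x =
      (pd i lam x * f x i + lam x * pd i (fun y => f y i) x) + ∑ j, Sig i j *
        (-(pd i lam x * pd j p x / p x) - lam x * pd i (pd j p) x / p x
          + lam x * pd j p x * pd i p x / (p x * p x) + 1 / 2 * pd i (pd j lam) x) := fun i => by
    have d1 := diff_div' (dS p dpp i x) (dp x) (h0 x)
    have d2 := (df i x).fun_sub d1
    rw [pd_add' i ((dl x).fun_mul d2) ((dS lam dpl i x).const_mul _),
      pd_mul' i (dl x) d2, pd_sub' i (df i x) d1, pd_div' i (dS p dpp i x) (dp x) h0,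
      pd_cmul' i _ (dS lam dpl i x), eS p dpp, eS lam dpl]
    have hs : ∑ j, Sig i j *
        (-(pd i lam x * pd j p x / p x) - lam x * pd i (pd j p) x / p x
          + lam x * pd j p x * pd i p x / (p x * p x) + 1 / 2 * pd i (pd j lam) x) =
        (-(pd i lam x / p x) + lam x * pd i p x / (p x * p x)) * (∑ j, Sig i j * pd j p x)
        - lam x / p x * (∑ j, Sig i j * pd i (pd j p) x)
        + 1 / 2 * ∑ j, Sig i j * pd i (pd j lam) x := by
      simp only [Finset.mul_sum, ← Finset.sum_sub_distrib, ← Finset.sum_add_distrib]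
      exact Finset.sum_congr rfl fun j _ => by ring
    rw [hs]
    have := h0 x
    field_simp
    ring
  have hanti : ∑ i, ∑ j, Sig i j * (pd i lam x * pd j p x) =
      ∑ i, ∑ j, Sig i j * (pd j lam x * pd i p x) := by
    rw [Finset.sum_comm]
    refine Finset.sum_congr rfl fun i _ => Finset.sum_congr rfl fun j _ => ?_
    rw [hSig.apply]
  have hS : p x * (1 / 2 * ∑ i, ∑ j, Sig i j * pd i (pd j (fun y => lam y / p y)) x)
      - lam x / p x * (1 / 2 * ∑ i, ∑ j, Sig i j * pd i (pd j p) x) =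
      ∑ i, ∑ j, Sig i j *
        (-(pd i lam x * pd j p x / p x) - lam x * pd i (pd j p) x / p x
          + lam x * pd j p x * pd i p x / (p x * p x) + 1 / 2 * pd i (pd j lam) x) := by
    have h3 : ∑ i, ∑ j, Sig i j *
        (-(pd i lam x * pd j p x / p x) - lam x * pd i (pd j p) x / p x
          + lam x * pd j p x * pd i p x / (p x * p x) + 1 / 2 * pd i (pd j lam) x) =
        ∑ i, ∑ j, Sig i j *
        (-(pd i lam x * pd j p x / p x) - lam x * pd i (pd j p) x / p x
          + lam x * pd j p x * pd i p x / (p x * p x) + 1 / 2 * pd i (pd j lam) x)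
        + 1 / (2 * p x) * (∑ i, ∑ j, Sig i j * (pd i lam x * pd j p x)
          - ∑ i, ∑ j, Sig i j * (pd j lam x * pd i p x)) := by
      rw [hanti]; ring
    rw [h3]
    simp only [Finset.mul_sum, ← Finset.sum_sub_distrib, ← Finset.sum_add_distrib]
    refine Finset.sum_congr rfl fun i _ => Finset.sum_congr rfl fun j _ => ?_
    rw [e2]
    have := h0 x
    field_simp
    ring
  have hF : p x * (∑ i, f x i * pd i (fun y => lam y / p y) x)
      + lam x / p x * ∑ i, (pd i p x * f x i + p x * pd i (fun y => f y i) x) =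
      ∑ i, (pd i lam x * f x i + lam x * pd i (fun y => f y i) x) := by
    simp only [Finset.mul_sum, ← Finset.sum_add_distrib]
    refine Finset.sum_congr rfl fun i _ => ?_
    rw [e1]
    have := h0 x
    field_simp
    ring
  have hD : divv (fun y i => p y * f y i) x =
      ∑ i, (pd i p x * f x i + p x * pd i (fun y => f y i) x) :=
    Finset.sum_congr rfl fun i _ => pd_mul' i (dp x) (df i x)
  have hD2 : divv (fun y i =>
          lam y * (f y i - Sig.mulVec (gradv p y) i / p y) +
            (1 / 2) * Sig.mulVec (gradv lam y) i) x = _ :=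
    Finset.sum_congr rfl fun i _ => hR i
  rw [hD2, Finset.sum_add_distrib, ← hS, ← hF]
  unfold gen genAdj
  rw [hD, trace_symm' Sig hSig, trace_symm' Sig hSig]
  simp only [hess, Matrix.of_apply]
  ring
end
end

section
/- Let (Ω, ℱ, ν) be a measure space with ν a finite measure, and let p, h, q₀ : Ω → ℝ be bounded measurable functions with p ≥ c for some constant c > 0, q₀ ≥ c' for some constant c' > 0, and ∫ q₀ dν = 1. For ε in a neighbourhood of 0 (small enough that p + εh ≥ c/2), define Z(ε) := ∫ (p + εh) dν, q_ε := (p + εh)/Z(ε), and F(ε) := ∫ q_ε · log(q_ε/q₀) dν. Then F is differentiable at ε = 0 with F'(0) = (1/Z(0)) · ∫ h(x) · [ log(q(x)/q₀(x)) − ∫ q·log(q/q₀) dν ] dν(x), where q := p/Z(0). -/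
open MeasureTheory

lemma aux_abs_log_le {a b x : ℝ} (ha : 0 < a) (h1 : a ≤ x) (h2 : x ≤ b) :
    |Real.log x| ≤ |Real.log a| + |Real.log b| := by
  have h3 := Real.log_le_log ha h1
  have h4 := Real.log_le_log (ha.trans_le h1) h2
  rw [abs_le]
  have := neg_abs_le (Real.log a)
  have := le_abs_self (Real.log b)
  have := abs_nonneg (Real.log a)
  have := abs_nonneg (Real.log b)
  constructor <;> linarith

lemma aux_int {Ω : Type*} [MeasurableSpace Ω] {ν : Measure Ω} [IsFiniteMeasure ν]
    {f : Ω → ℝ} (hf : Measurable f) (C : ℝ) (hC : ∀ x, |f x| ≤ C) : Integrable f ν :=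
  Integrable.of_bound hf.aestronglyMeasurable C (Filter.Eventually.of_forall hC)

/-- Gateaux derivative of the KL divergence `F(ε) = ∫ q_ε log(q_ε/q₀) dν` of the
normalization `q_ε = (p + εh)/Z(ε)`, `Z(ε) = ∫ (p + εh) dν`, with respect to the
unnormalized density: `F'(0) = (1/Z(0)) ∫ h (log(q/q₀) − ∫ q log(q/q₀) dν) dν`
where `q = p/Z(0)`. -/
theorem kl_gateaux_derivative
    {Ω : Type*} [MeasurableSpace Ω] (ν : Measure Ω) [IsFiniteMeasure ν]
    (p h q₀ : Ω → ℝ)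
    (hpm : Measurable p) (hhm : Measurable h) (hq₀m : Measurable q₀)
    (Bp Bh Bq : ℝ)
    (hpB : ∀ x, |p x| ≤ Bp) (hhB : ∀ x, |h x| ≤ Bh) (hqB : ∀ x, |q₀ x| ≤ Bq)
    (c c' : ℝ) (hc : 0 < c) (hc' : 0 < c')
    (hpc : ∀ x, c ≤ p x) (hq₀c : ∀ x, c' ≤ q₀ x)
    (hq₀int : ∫ x, q₀ x ∂ν = 1)
    (Z : ℝ → ℝ) (hZ : ∀ ε, Z ε = ∫ x, (p x + ε * h x) ∂ν)
    (q : ℝ → Ω → ℝ) (hq : ∀ ε x, q ε x = (p x + ε * h x) / Z ε)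
    (F : ℝ → ℝ) (hF : ∀ ε, F ε = ∫ x, q ε x * Real.log (q ε x / q₀ x) ∂ν) :
    HasDerivAt F
      ((1 / Z 0) *
        ∫ x, h x *
          (Real.log (q 0 x / q₀ x) - ∫ y, q 0 y * Real.log (q 0 y / q₀ y) ∂ν) ∂ν)
      0 := by
  have hνpos : 0 < ν.real Set.univ := by
    rw [measureReal_def, ENNReal.toReal_pos_iff]
    refine ⟨?_, measure_lt_top _ _⟩
    rw [pos_iff_ne_zero]
    intro h0
    rw [Measure.measure_univ_eq_zero] at h0
    subst h0
    simp at hq₀int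
  have hpi : Integrable p ν := aux_int hpm Bp hpB
  have hhi : Integrable h ν := aux_int hhm Bh hhB
  have hZ' : ∀ ε, Z ε = ∫ x, p x ∂ν + ε * ∫ x, h x ∂ν := by
    intro ε
    rw [hZ, integral_add hpi (hhi.const_mul ε), integral_const_mul]
  obtain ⟨δ, hδ, hδb⟩ : ∃ δ : ℝ, 0 < δ ∧ δ * (|Bh| + 1) = c / 2 := by
    have : 0 < |Bh| + 1 := by positivity
    exact ⟨c / 2 / (|Bh| + 1), by positivity, by field_simp⟩
  have hs : Metric.ball (0:ℝ) δ ∈ nhds (0:ℝ) := Metric.ball_mem_nhds _ hδ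
  have hεh : ∀ ε ∈ Metric.ball (0:ℝ) δ, ∀ x, |ε * h x| ≤ c / 2 := by
    intro ε hε x
    rw [mem_ball_zero_iff, Real.norm_eq_abs] at hε
    rw [abs_mul, ← hδb]
    have := (hhB x).trans (le_abs_self Bh)
    gcongr
    linarith
  have hlo : ∀ ε ∈ Metric.ball (0:ℝ) δ, ∀ x, c / 2 ≤ p x + ε * h x := by
    intro ε hε x
    have := (abs_le.1 (hεh ε hε x)).1
    linarith [hpc x]
  have hhi' : ∀ ε ∈ Metric.ball (0:ℝ) δ, ∀ x, p x + ε * h x ≤ Bp + c / 2 := by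
    intro ε hε x
    have := (abs_le.1 (hεh ε hε x)).2
    linarith [(abs_le.1 (hpB x)).2]
  have h0mem : (0:ℝ) ∈ Metric.ball (0:ℝ) δ := Metric.mem_ball_self hδ
  obtain ⟨L, hL⟩ : ∃ L, L = |Real.log (c / 2)| + |Real.log (Bp + c / 2)| := ⟨_, rfl⟩
  obtain ⟨M, hM⟩ : ∃ M, M = |Real.log c'| + |Real.log Bq| := ⟨_, rfl⟩
  have hLb : ∀ ε ∈ Metric.ball (0:ℝ) δ, ∀ x, |Real.log (p x + ε * h x)| ≤ L := by
    intro ε hε x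
    rw [hL]
    exact aux_abs_log_le (by positivity) (hlo ε hε x) (hhi' ε hε x)
  have hMb : ∀ x, |Real.log (q₀ x)| ≤ M := by
    intro x
    rw [hM]
    exact aux_abs_log_le hc' (hq₀c x) ((le_abs_self _).trans (hqB x))
  have hLM : ∀ ε ∈ Metric.ball (0:ℝ) δ, ∀ x,
      |Real.log (p x + ε * h x) - Real.log (q₀ x)| ≤ L + M := fun ε hε x =>
    (abs_sub _ _).trans (add_le_add (hLb ε hε x) (hMb x))
  have hub : ∀ ε ∈ Metric.ball (0:ℝ) δ, ∀ x, |p x + ε * h x| ≤ Bp + c / 2 := fun ε hε x => by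
    rw [abs_of_nonneg (by linarith [hlo ε hε x])]
    exact hhi' ε hε x
  have hGi : ∀ ε ∈ Metric.ball (0:ℝ) δ, Integrable
      (fun x => (p x + ε * h x) * (Real.log (p x + ε * h x) - Real.log (q₀ x))) ν := by
    intro ε hε
    refine aux_int (by fun_prop) ((Bp + c / 2) * (L + M)) fun x => ?_
    rw [abs_mul]
    exact mul_le_mul (hub ε hε x) (hLM ε hε x) (abs_nonneg _) ((abs_nonneg _).trans (hub ε hε x))
  have hG := (hasDerivAt_integral_of_dominated_loc_of_deriv_le (μ := ν) (x₀ := (0:ℝ)) (𝕜 := ℝ)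
    (F := fun ε x => (p x + ε * h x) * (Real.log (p x + ε * h x) - Real.log (q₀ x)))
    (F' := fun ε x => h x * (Real.log (p x + ε * h x) - Real.log (q₀ x)) + h x)
    (bound := fun _ => Bh * (L + M) + Bh) hs
    (Filter.Eventually.of_forall fun ε => Measurable.aestronglyMeasurable (by fun_prop))
    (hGi 0 h0mem) (Measurable.aestronglyMeasurable (by fun_prop))
    (Filter.Eventually.of_forall fun x ε hε => by
      refine (abs_add_le _ _).trans (add_le_add ?_ (hhB x))
      rw [abs_mul]
      exact mul_le_mul (hhB x) (hLM ε hε x) (abs_nonneg _) ((abs_nonneg _).trans (hhB x)))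
    (integrable_const _)
    (Filter.Eventually.of_forall fun x ε hε => by
      have hpos : p x + ε * h x ≠ 0 := by linarith [hlo ε hε x]
      have h1 : HasDerivAt (fun ε : ℝ => p x + ε * h x) (h x) ε := by
        simpa using ((hasDerivAt_id ε).mul_const (h x)).const_add (p x)
      have h2 := h1.mul ((h1.log hpos).sub_const (Real.log (q₀ x)))
      refine h2.congr_deriv ?_
      rw [mul_div_cancel₀ _ hpos])).2
  have hZpos : ∀ ε ∈ Metric.ball (0:ℝ) δ, 0 < Z ε := by
    intro ε hε
    have h1 : ∫ _, c / 2 ∂ν ≤ Z ε := by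
      rw [hZ]
      exact integral_mono (integrable_const _) (hpi.add (hhi.const_mul ε)) (hlo ε hε)
    rw [integral_const, smul_eq_mul] at h1
    have : 0 < ν.real Set.univ * (c / 2) := by positivity
    linarith
  have hZd : HasDerivAt Z (∫ x, h x ∂ν) 0 := by
    have : Z = fun ε => ∫ x, p x ∂ν + ε * ∫ x, h x ∂ν := funext hZ'
    rw [this]
    simpa using ((hasDerivAt_id (0:ℝ)).mul_const (∫ x, h x ∂ν)).const_add (∫ x, p x ∂ν)
  have hlogq : ∀ ε ∈ Metric.ball (0:ℝ) δ, ∀ x, Real.log (q ε x / q₀ x)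
      = (Real.log (p x + ε * h x) - Real.log (q₀ x)) - Real.log (Z ε) := by
    intro ε hε x
    have h1 : p x + ε * h x ≠ 0 := by linarith [hlo ε hε x]
    have h2 := (hZpos ε hε).ne'
    have h3 : q₀ x ≠ 0 := by linarith [hq₀c x]
    rw [hq, Real.log_div (div_ne_zero h1 h2) h3, Real.log_div h1 h2]
    ring
  have hFG : ∀ ε ∈ Metric.ball (0:ℝ) δ, F ε =
      (∫ x, (p x + ε * h x) * (Real.log (p x + ε * h x) - Real.log (q₀ x)) ∂ν) / Z ε
        - Real.log (Z ε) := by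
    intro ε hε
    have h2 := (hZpos ε hε).ne'
    have h4 : ∀ x, q ε x * Real.log (q ε x / q₀ x) =
        (Z ε)⁻¹ * ((p x + ε * h x) * (Real.log (p x + ε * h x) - Real.log (q₀ x)))
        - (Real.log (Z ε) / Z ε) * (p x + ε * h x) := by
      intro x
      rw [hlogq ε hε x, hq]
      field_simp
    have hui : Integrable (fun x => p x + ε * h x) ν := hpi.add (hhi.const_mul ε)
    rw [hF]
    simp_rw [h4]
    rw [integral_sub ((hGi ε hε).const_mul _) (hui.const_mul _),
      integral_const_mul, integral_const_mul, ← hZ]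
    field_simp
  have hZ0 := (hZpos 0 h0mem).ne'
  have hD := (hG.div hZd hZ0).sub (hZd.log hZ0)
  have hFe : F =ᶠ[nhds 0] _ := Filter.mem_of_superset hs hFG
  refine (hD.congr_of_eventuallyEq hFe).congr_deriv ?_
  have hli : Integrable (fun x => h x * (Real.log (p x + 0 * h x) - Real.log (q₀ x))) ν := by
    refine aux_int (by fun_prop) (Bh * (L + M)) fun x => ?_
    rw [abs_mul]
    exact mul_le_mul (hhB x) (hLM 0 h0mem x) (abs_nonneg _) ((abs_nonneg _).trans (hhB x))
  beta_reduce
  rw [← hF, hFG 0 h0mem]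
  obtain ⟨G, hGd⟩ : ∃ G, G =
    ∫ x, (p x + 0 * h x) * (Real.log (p x + 0 * h x) - Real.log (q₀ x)) ∂ν := ⟨_, rfl⟩
  rw [← hGd]
  have h5 : ∀ x, h x * (Real.log (q 0 x / q₀ x) - (G / Z 0 - Real.log (Z 0))) =
      h x * (Real.log (p x + 0 * h x) - Real.log (q₀ x)) - (G / Z 0) * h x := by
    intro x
    rw [hlogq 0 h0mem x]
    ring
  simp_rw [h5]
  rw [integral_sub hli (hhi.const_mul _), integral_add hli hhi, integral_const_mul]
  field_simp
  ring
end

section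
/- Let n ∈ ℕ, T > 0, let Φ : ℝⁿ × ℝ → ℝⁿ be continuously differentiable, let p, h : [0,T] → ℝ be continuous, and let x : ℝ × [0,T] → ℝⁿ satisfy x(ε, 0) = x₀ for all ε and ∂ₜ x(ε,t) = Φ(x(ε,t), p(t) + ε h(t)). Assume the sensitivity s(t) := ∂_ε x(ε,t)|_{ε=0} exists, is continuous, and satisfies s(0) = 0 and s'(t) = ∂_x Φ(x(0,t), p(t))·s(t) + ∂_p Φ(x(0,t), p(t))·h(t). Let f : ℝⁿ → ℝ be differentiable at x(0,T), and assume ε ↦ f(x(ε,T)) is differentiable at 0 with derivative ⟨∇f(x(0,T)), s(T)⟩. Let λ : [0,T] → ℝⁿ be differentiable with −λ'(t) = (∂_x Φ(x(0,t), p(t)))ᵀ·λ(t) and λ(T) = ∇f(x(0,T)). Then d/dε f(x(ε,T)) at ε = 0 equals ∫₀ᵀ ⟨λ(t), ∂_p Φ(x(0,t), p(t))⟩ · h(t) dt. -/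
open scoped RealInnerProductSpace

/-- The adjoint method for a terminal cost constrained by the ODE `ẋ = Φ(x, p(t))`:
the derivative at `ε = 0` of `ε ↦ f(x_ε(T))`, where `x_ε` solves the ODE with parameter
path `p + εh`, equals `∫₀ᵀ ⟨λ(t), ∂_p Φ(x(t),p(t))⟩ h(t) dt`, with `λ` solving the
backwards adjoint ODE `−λ' = (∂_x Φ)ᵀ λ`, `λ(T) = ∇f(x(T))`. -/
theorem adjoint_method_terminal_cost
    (n : ℕ) (T : ℝ) (hT : 0 < T)
    (Φ : EuclideanSpace ℝ (Fin n) × ℝ → EuclideanSpace ℝ (Fin n))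
    (hΦ : ContDiff ℝ 1 Φ)
    (p h : ℝ → ℝ) (hp : ContinuousOn p (Set.Icc 0 T)) (hh : ContinuousOn h (Set.Icc 0 T))
    (x₀ : EuclideanSpace ℝ (Fin n))
    (x : ℝ → ℝ → EuclideanSpace ℝ (Fin n))
    (hx0 : ∀ ε, x ε 0 = x₀)
    (hxode : ∀ ε, ∀ t ∈ Set.Icc (0 : ℝ) T,
      HasDerivAt (x ε) (Φ (x ε t, p t + ε * h t)) t)
    -- the sensitivity `s(t) = ∂_ε x(ε,t)|_{ε=0}` exists, is continuous, `s(0) = 0`,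
    -- and solves the linearized ODE
    (s : ℝ → EuclideanSpace ℝ (Fin n))
    (hsdef : ∀ t ∈ Set.Icc (0 : ℝ) T, HasDerivAt (fun ε => x ε t) (s t) 0)
    (hscont : ContinuousOn s (Set.Icc 0 T))
    (hs0 : s 0 = 0)
    (hsode : ∀ t ∈ Set.Icc (0 : ℝ) T, HasDerivAt s
      (fderiv ℝ Φ (x 0 t, p t) (s t, 0) + h t • fderiv ℝ Φ (x 0 t, p t) (0, 1)) t)
    -- terminal cost and chain rule
    (f : EuclideanSpace ℝ (Fin n) → ℝ)
    (hf : DifferentiableAt ℝ f (x 0 T))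
    (hchain : HasDerivAt (fun ε => f (x ε T)) ⟪gradient f (x 0 T), s T⟫ 0)
    -- the adjoint variable: `−λ' = (∂_x Φ)ᵀ λ`, `λ(T) = ∇f(x(0,T))`
    (lam : ℝ → EuclideanSpace ℝ (Fin n))
    (hlamT : lam T = gradient f (x 0 T))
    (hlamode : ∀ t ∈ Set.Icc (0 : ℝ) T, HasDerivAt lam
      (-(ContinuousLinearMap.adjoint
          ((fderiv ℝ Φ (x 0 t, p t)).comp
            (ContinuousLinearMap.inl ℝ (EuclideanSpace ℝ (Fin n)) ℝ)) (lam t))) t) :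
    HasDerivAt (fun ε => f (x ε T))
      (∫ t in (0 : ℝ)..T, ⟪lam t, fderiv ℝ Φ (x 0 t, p t) (0, 1)⟫ * h t) 0 := by
  have hx_cont : ContinuousOn (x 0) (Set.Icc 0 T) := fun t ht =>
    (hxode 0 t ht).continuousAt.continuousWithinAt
  have hlam_cont : ContinuousOn lam (Set.Icc 0 T) := fun t ht =>
    (hlamode t ht).continuousAt.continuousWithinAt
  have hD : ContinuousOn (fun t => fderiv ℝ Φ (x 0 t, p t)) (Set.Icc 0 T) :=
    (hΦ.continuous_fderiv one_ne_zero).comp_continuousOn (hx_cont.prodMk hp)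
  have hcont : ContinuousOn (fun t => ⟪lam t, fderiv ℝ Φ (x 0 t, p t) (0, 1)⟫ * h t)
      (Set.Icc 0 T) :=
    (hlam_cont.inner (hD.clm_apply continuousOn_const)).mul hh
  have hderiv : ∀ t ∈ Set.uIcc 0 T, HasDerivAt (fun t => ⟪lam t, s t⟫)
      (⟪lam t, fderiv ℝ Φ (x 0 t, p t) (0, 1)⟫ * h t) t := by
    intro t ht
    rw [Set.uIcc_of_le hT.le] at ht
    have := (hlamode t ht).inner ℝ (hsode t ht)
    refine HasDerivAt.congr_deriv this ?_
    rw [inner_neg_left, ContinuousLinearMap.adjoint_inner_left, inner_add_right,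
      inner_smul_right]
    simp only [ContinuousLinearMap.comp_apply, ContinuousLinearMap.inl_apply]
    ring
  have hint := intervalIntegral.integral_eq_sub_of_hasDerivAt hderiv
    (hcont.intervalIntegrable_of_Icc hT.le)
  rw [hint, hs0, inner_zero_right, sub_zero, hlamT]
  exact hchain
end
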